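/- Let m ≥ 1 be an integer, let B̄ be the closed ball of center c and radius r > 0 in ℝ^m, and let Φ : B̄ → ℝ^m be a continuous map. Let x₀ ∈ ℝ^m with ‖x₀ − c‖ < r, and suppose that ‖Φ(x) − x‖ < r − ‖x₀ − c‖ for every x ∈ B̄. Then x₀ belongs to the image Φ(B̄). -/

import Mathlib

open Set Metric MeasureTheory

/-- Lagrange interpolation weights for `t ↦ det (1 + t A)`. -/
lemma qs_det_interp {n : ℕ} (v : ℕ → ℝ) (hv : Function.Injective v)
    (A : EuclideanSpace ℝ (Fin n) →L[ℝ] EuclideanSpace ℝ (Fin n)) :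
    (ContinuousLinearMap.id ℝ _ + A).det = ∑ i ∈ Finset.range (n + 1),
      (Lagrange.basis (Finset.range (n + 1)) v i).eval 1 *
        (ContinuousLinearMap.id ℝ _ + v i • A).det := by
  classical
  let b := (EuclideanSpace.basisFun (Fin n) ℝ).toBasis
  let M := LinearMap.toMatrix b b (A : EuclideanSpace ℝ (Fin n) →ₗ[ℝ] _)
  let p : Polynomial ℝ := Matrix.det
    ((Polynomial.X : Polynomial ℝ) • M.map Polynomial.C + (1 : Matrix (Fin n) (Fin n) ℝ).map Polynomial.C)
  have hp : ∀ t : ℝ, p.eval t = (ContinuousLinearMap.id ℝ _ + t • A).det := by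
    intro t
    have h1 : (ContinuousLinearMap.id ℝ _ + t • A).det = (1 + t • M).det := by
      rw [ContinuousLinearMap.det, ← LinearMap.det_toMatrix b]
      congr 1
      simp [M]
    rw [h1]
    simp only [p]
    rw [← Polynomial.coe_evalRingHom, RingHom.map_det]
    congr 1
    ext i j
    simp only [Matrix.one_apply, Matrix.map_apply, Matrix.add_apply, Matrix.smul_apply,
      RingHom.mapMatrix_apply, Polynomial.coe_evalRingHom, smul_eq_mul, Polynomial.eval_add,
      Polynomial.eval_mul, Polynomial.eval_X, Polynomial.eval_C]
    ring
  have hdeg : p.degree < (Finset.range (n + 1)).card := by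
    rw [Finset.card_range]
    have := Polynomial.natDegree_det_X_add_C_le M (1 : Matrix (Fin n) (Fin n) ℝ)
    rw [Fintype.card_fin] at this
    refine lt_of_le_of_lt Polynomial.degree_le_natDegree ?_
    exact_mod_cast Nat.lt_succ_of_le this
  have h := Lagrange.eq_interpolate (s := Finset.range (n + 1)) (v := v) hv.injOn hdeg
  have h2 := congrArg (Polynomial.eval 1) h
  rw [hp, one_smul, Lagrange.interpolate_apply, Polynomial.eval_finsetSum] at h2
  rw [h2]
  refine Finset.sum_congr rfl fun i _ => ?_
  rw [Polynomial.eval_mul, Polynomial.eval_C, hp, mul_comm]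

/-- For small `t`, `det (1 + t A) > 0`. -/
lemma qs_det_pos {n : ℕ} (A : EuclideanSpace ℝ (Fin n) →L[ℝ] EuclideanSpace ℝ (Fin n))
    (t : ℝ) (ht : 0 ≤ t) (hA : t * ‖A‖ < 1) :
    0 < (ContinuousLinearMap.id ℝ _ + t • A).det := by
  have hne : ∀ s ∈ Icc 0 t, (ContinuousLinearMap.id ℝ _ + s • A).det ≠ 0 := by
    intro s hs h0
    have := LinearMap.bot_lt_ker_of_det_eq_zero (f := ((ContinuousLinearMap.id ℝ _ + s • A :
      EuclideanSpace ℝ (Fin n) →L[ℝ] EuclideanSpace ℝ (Fin n)) :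
      EuclideanSpace ℝ (Fin n) →ₗ[ℝ] EuclideanSpace ℝ (Fin n))) h0
    obtain ⟨w, hw, hw0⟩ := Submodule.exists_mem_ne_zero_of_ne_bot this.ne'
    have hw' : w + s • A w = 0 := by simpa using hw
    have h1 : ‖w‖ = s * ‖A w‖ := by
      conv_lhs => rw [eq_neg_of_add_eq_zero_left hw']
      rw [norm_neg, norm_smul, Real.norm_of_nonneg hs.1]
    have h2 := A.le_opNorm w
    have h3 : 0 < ‖w‖ := norm_pos_iff.2 hw0
    have h4 : s * ‖A‖ < 1 := lt_of_le_of_lt (by gcongr; exact hs.2) hA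
    nlinarith [mul_le_mul_of_nonneg_left h2 hs.1]
  have hc : Continuous fun s : ℝ => (ContinuousLinearMap.id ℝ _ + s • A).det :=
    ContinuousLinearMap.continuous_det.comp (by fun_prop)
  by_contra hcon
  push Not at hcon
  obtain ⟨s, hs, h⟩ := intermediate_value_Icc' ht hc.continuousOn
    (show (0 : ℝ) ∈ Icc _ _ from ⟨hcon, by simp [ContinuousLinearMap.det]⟩)
  exact hne s hs h

/-- A Lipschitz map on the ball vanishing on the sphere: small perturbations of the identity
are bijective on the ball. -/
lemma qs_bij {n : ℕ} {R : ℝ} (h : EuclideanSpace ℝ (Fin n) → EuclideanSpace ℝ (Fin n))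
    (K : ℝ) (hK0 : 0 ≤ K) (hK : ∀ x ∈ closedBall 0 R, ∀ y ∈ closedBall 0 R, ‖h x - h y‖ ≤ K * ‖x - y‖)
    (h0 : ∀ x, ‖x‖ = R → h x = 0) (t : ℝ) (ht : 0 ≤ t) (htK : t * K < 1)
    (hmaps : MapsTo (fun x => x + t • h x) (closedBall 0 R) (closedBall 0 R)) :
    InjOn (fun x => x + t • h x) (closedBall 0 R) ∧
      (fun x => x + t • h x) '' (closedBall 0 R) = closedBall 0 R := by
  classical
  constructor
  · intro x hx y hy hxy
    simp only at hxy
    have h1 : x - y = t • (h y - h x) := by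
      rw [smul_sub, sub_eq_sub_iff_add_eq_add, hxy, add_comm]
    have h2 : ‖x - y‖ = t * ‖h y - h x‖ := by
      conv_lhs => rw [h1]
      rw [norm_smul, Real.norm_of_nonneg ht]
    have h3 := mul_le_mul_of_nonneg_left (hK y hy x hx) ht
    rw [norm_sub_rev y x] at h3
    have h4 : ‖x - y‖ ≤ 0 := by
      by_contra hc
      push Not at hc
      nlinarith
    exact sub_eq_zero.1 (norm_le_zero_iff.1 h4)
  · refine Subset.antisymm hmaps.image_subset ?_
    let k : EuclideanSpace ℝ (Fin n) → EuclideanSpace ℝ (Fin n) :=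
      fun x => if ‖x‖ ≤ R then h x else 0
    have kin : ∀ x, ‖x‖ ≤ R → k x = h x := fun x hx => if_pos hx
    have kout : ∀ x, ¬ ‖x‖ ≤ R → k x = 0 := fun x hx => if_neg hx
    have key : ∀ x y, ‖x‖ ≤ R → ¬ ‖y‖ ≤ R → ‖h x‖ ≤ K * ‖x - y‖ := by
      intro x y hx hy
      have hc : Continuous fun s : ℝ => ‖x + s • (y - x)‖ := by fun_prop
      obtain ⟨s, hs, hsR⟩ := intermediate_value_Icc zero_le_one hc.continuousOn
        (show R ∈ Icc _ _ from ⟨by simpa using hx, by simpa using (not_le.1 hy).le⟩)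
      simp only at hsR
      have := hK x (by simpa using hx) (x + s • (y - x)) (by simpa using hsR.le)
      rw [h0 _ hsR, sub_zero, sub_add_cancel_left, norm_neg, norm_smul,
        Real.norm_of_nonneg hs.1, norm_sub_rev y x] at this
      refine this.trans ?_
      have : s * ‖x - y‖ ≤ ‖x - y‖ := mul_le_of_le_one_left (norm_nonneg _) hs.2
      gcongr
    have hk : ∀ x y, ‖k x - k y‖ ≤ K * ‖x - y‖ := by
      intro x y
      by_cases hx : ‖x‖ ≤ R <;> by_cases hy : ‖y‖ ≤ R
      · rw [kin x hx, kin y hy]; exact hK x (by simpa using hx) y (by simpa using hy)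
      · rw [kin x hx, kout y hy, sub_zero]; exact key x y hx hy
      · rw [kout x hx, kin y hy, zero_sub, norm_neg, norm_sub_rev]; exact key y x hy hx
      · rw [kout x hx, kout y hy]; simp; positivity
    intro y hy
    have hcontr : ContractingWith (Real.toNNReal (t * K)) (fun x => y - t • k x) := by
      refine ⟨by simpa using htK, LipschitzWith.of_dist_le_mul fun a b => ?_⟩
      rw [dist_eq_norm, dist_eq_norm, sub_sub_sub_cancel_left, ← smul_sub, norm_smul,
        Real.norm_of_nonneg ht, Real.coe_toNNReal _ (by positivity), norm_sub_rev a b, mul_assoc]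
      exact mul_le_mul_of_nonneg_left (hk b a) ht
    have hfix : y - t • k hcontr.fixedPoint = hcontr.fixedPoint := hcontr.fixedPoint_isFixedPt
    set x := hcontr.fixedPoint
    have hx : ‖x‖ ≤ R := by
      by_contra hx
      rw [kout x hx, smul_zero, sub_zero] at hfix
      exact hx (by rw [← hfix]; simpa using hy)
    refine ⟨x, by simpa using hx, ?_⟩
    rw [kin x hx] at hfix
    simp only
    rw [← eq_sub_iff_add_eq, hfix]

/-- No C¹ retraction onto the sphere. -/
lemma qs_no_retraction {n : ℕ} {R : ℝ} (hR : 0 < R)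
    (f : EuclideanSpace ℝ (Fin n) → EuclideanSpace ℝ (Fin n)) (hf : ContDiff ℝ 1 f)
    (hfR : ∀ x, ‖f x‖ = R) (hid : ∀ x, ‖x‖ = R → f x = x) : False := by
  let h : EuclideanSpace ℝ (Fin n) → EuclideanSpace ℝ (Fin n) := fun x => f x - x
  have hh : ContDiff ℝ 1 h := hf.sub contDiff_id
  have hD : ∀ x, HasFDerivAt h (fderiv ℝ h x) x :=
    fun x => (hh.differentiable one_ne_zero x).hasFDerivAt
  have hDc : Continuous (fderiv ℝ h) := hh.continuous_fderiv one_ne_zero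
  obtain ⟨K, hK⟩ := (isCompact_closedBall (0 : EuclideanSpace ℝ (Fin n)) R).exists_bound_of_continuousOn
    hDc.continuousOn
  have hK0 : 0 ≤ K := (norm_nonneg _).trans (hK 0 (by simpa using hR.le))
  have hLip : ∀ x ∈ closedBall (0 : EuclideanSpace ℝ (Fin n)) R, ∀ y ∈ closedBall 0 R,
      ‖h x - h y‖ ≤ K * ‖x - y‖ := fun x hx y hy =>
    (convex_closedBall 0 R).norm_image_sub_le_of_norm_fderiv_le
      (fun x _ => (hD x).differentiableAt) hK hy hx
  have hvol : ∀ t : ℝ, 0 ≤ t → t ≤ 1 → t * K < 1 →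
      ∫ x in closedBall 0 R, (ContinuousLinearMap.id ℝ _ + t • fderiv ℝ h x).det =
        volume.real (closedBall (0 : EuclideanSpace ℝ (Fin n)) R) := by
    intro t ht ht1 htK
    have hb := qs_bij h K hK0 hLip (fun x hx => by simp [h, hid x hx]) t ht htK (by
      intro x hx
      have hx' : ‖x‖ ≤ R := by simpa using hx
      simp only [mem_closedBall_zero_iff]
      have : x + t • h x = (1 - t) • x + t • f x := by simp only [h]; module
      rw [this]
      refine (norm_add_le _ _).trans ?_
      rw [norm_smul, norm_smul, Real.norm_of_nonneg ht, Real.norm_of_nonneg (by linarith), hfR]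
      nlinarith)
    have hcv := integral_image_eq_integral_abs_det_fderiv_smul volume
      (measurableSet_closedBall (x := (0 : EuclideanSpace ℝ (Fin n))) (ε := R))
      (f := fun x => x + t • h x) (f' := fun x => ContinuousLinearMap.id ℝ _ + t • fderiv ℝ h x)
      (fun x _ => ((hasFDerivAt_id x).add ((hD x).const_smul t)).hasFDerivWithinAt) hb.1
      (fun _ => (1 : ℝ))
    rw [hb.2] at hcv
    simp only [smul_eq_mul, mul_one, integral_const, MeasurableSet.univ,
      measureReal_restrict_apply, univ_inter] at hcv
    rw [hcv]
    refine setIntegral_congr_fun measurableSet_closedBall fun x hx => ?_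
    rw [abs_of_pos]
    refine qs_det_pos _ t ht (lt_of_le_of_lt ?_ htK)
    exact mul_le_mul_of_nonneg_left (hK x hx) ht
  have hzero : ∀ x, (ContinuousLinearMap.id ℝ _ + fderiv ℝ h x).det = 0 := by
    intro x
    have hfd : HasFDerivAt f (ContinuousLinearMap.id ℝ _ + fderiv ℝ h x) x := by
      have := (hasFDerivAt_id x).add (hD x)
      have e : (id + h) = f := by ext1 y; simp [h]
      rwa [e] at this
    set A := ContinuousLinearMap.id ℝ _ + fderiv ℝ h x
    by_contra hne
    have hsurj : Function.Surjective A :=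
      (ContinuousLinearMap.toContinuousLinearEquivOfDetNeZero A hne).surjective
    obtain ⟨w, hw⟩ := hsurj (f x)
    have h1 := hfd.norm_sq
    have h2 : HasFDerivAt (fun y => ‖f y‖ ^ 2) (0 : EuclideanSpace ℝ (Fin n) →L[ℝ] ℝ) x := by
      simp only [hfR]; exact hasFDerivAt_const _ _
    have h3 := congrArg (fun L => L w) (h1.unique h2)
    simp [hw, hfR] at h3
    exact hR.ne' h3
  let v : ℕ → ℝ := fun i => 1 / ((i + 1 : ℝ) * (K + 1))
  have hvpos : ∀ i, 0 < v i := fun i => by positivity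
  have hvinj : Function.Injective v := by
    intro i j hij
    simp only [v, one_div, inv_inj] at hij
    have := mul_right_cancel₀ (by positivity) hij
    exact_mod_cast add_right_cancel this
  have hvle : ∀ i, v i * (K + 1) ≤ 1 := by
    intro i
    have : v i * (K + 1) = 1 / (i + 1 : ℝ) := by simp only [v]; field_simp
    rw [this, div_le_one (by positivity)]
    linarith [(Nat.cast_nonneg i : (0 : ℝ) ≤ i)]
  have hint : ∀ t : ℝ, IntegrableOn
      (fun x => (ContinuousLinearMap.id ℝ _ + t • fderiv ℝ h x).det)
      (closedBall (0 : EuclideanSpace ℝ (Fin n)) R) := fun t =>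
    (ContinuousLinearMap.continuous_det.comp (by fun_prop)).continuousOn.integrableOn_compact
      (isCompact_closedBall _ _)
  have hsum : (∑ i ∈ Finset.range (n + 1),
      (Lagrange.basis (Finset.range (n + 1)) v i).eval 1) = 1 := by
    rw [← Polynomial.eval_finsetSum, Lagrange.sum_basis hvinj.injOn (by simp)]
    simp
  have hfin : (0 : ℝ) = volume.real (closedBall (0 : EuclideanSpace ℝ (Fin n)) R) := by
    calc (0 : ℝ) = ∫ x in closedBall (0 : EuclideanSpace ℝ (Fin n)) R,
          (ContinuousLinearMap.id ℝ _ + fderiv ℝ h x).det := by simp [hzero]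
      _ = ∫ x in closedBall (0 : EuclideanSpace ℝ (Fin n)) R, ∑ i ∈ Finset.range (n + 1),
          (Lagrange.basis (Finset.range (n + 1)) v i).eval 1 *
            (ContinuousLinearMap.id ℝ _ + v i • fderiv ℝ h x).det := by
          simp_rw [← qs_det_interp v hvinj]
      _ = ∑ i ∈ Finset.range (n + 1), (Lagrange.basis (Finset.range (n + 1)) v i).eval 1 *
            volume.real (closedBall (0 : EuclideanSpace ℝ (Fin n)) R) := by
          rw [integral_finsetSum _ fun i _ => (hint (v i)).const_mul _]
          refine Finset.sum_congr rfl fun i _ => ?_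
          rw [integral_const_mul, hvol (v i) (hvpos i).le]
          · nlinarith [hvle i, hvpos i]
          · nlinarith [hvle i, hvpos i]
      _ = _ := by rw [← Finset.sum_mul, hsum, one_mul]
  have hp : 0 < volume.real (closedBall (0 : EuclideanSpace ℝ (Fin n)) R) :=
    ENNReal.toReal_pos (measure_closedBall_pos _ _ hR).ne' measure_closedBall_lt_top.ne
  exact hp.ne hfin

/-- A bounded continuous self-map has a fixed point (Brouwer). -/
lemma qs_brouwer {n : ℕ} {ρ : ℝ}
    (q : EuclideanSpace ℝ (Fin n) → EuclideanSpace ℝ (Fin n)) (hq : Continuous q)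
    (hb : ∀ x, ‖q x‖ ≤ ρ) : ∃ x, q x = x := by
  by_contra hno
  push Not at hno
  have hρ : 0 ≤ ρ := (norm_nonneg _).trans (hb 0)
  obtain ⟨p, hp, hpq, -⟩ := hq.exists_contDiff_approx (1 : ℕ∞)
    (ε := fun x => min 1 ‖x - q x‖) (by fun_prop)
    (fun x => lt_min one_pos (norm_pos_iff.2 (sub_ne_zero.2 (hno x).symm)))
  have hp1 : ∀ x, p x ≠ x := by
    intro x hx
    have := (hpq x).trans_le (min_le_right _ _)
    rw [hx, dist_eq_norm] at this
    exact lt_irrefl _ this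
  have hp2 : ∀ x, ‖p x‖ < ρ + 1 := by
    intro x
    have := (hpq x).trans_le (min_le_left _ _)
    rw [dist_eq_norm] at this
    have h2 := norm_le_norm_add_norm_sub (q x) (p x)
    rw [norm_sub_rev] at h2
    linarith [hb x]
  let χ : ContDiffBump (0 : EuclideanSpace ℝ (Fin n)) := ⟨ρ + 1, ρ + 2, by linarith, by linarith⟩
  let F : EuclideanSpace ℝ (Fin n) → EuclideanSpace ℝ (Fin n) := fun x => x - χ x • p x
  have hF0 : ∀ x, F x ≠ 0 := by
    intro x hx
    have hx' : x = χ x • p x := sub_eq_zero.1 hx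
    by_cases hxr : ‖x‖ ≤ ρ + 1
    · rw [χ.one_of_mem_closedBall (by simpa using hxr), one_smul] at hx'
      exact hp1 x hx'.symm
    · apply hxr
      rw [hx', norm_smul, Real.norm_of_nonneg χ.nonneg]
      exact (mul_le_of_le_one_left (norm_nonneg _) χ.le_one).trans (hp2 x).le
  have hFs : ContDiff ℝ 1 F := contDiff_id.sub (χ.contDiff.smul (by exact_mod_cast hp))
  have hR : (0 : ℝ) < ρ + 2 := by linarith
  refine qs_no_retraction hR (fun x => ((ρ + 2) * ‖F x‖⁻¹) • F x) ?_ ?_ ?_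
  · exact (contDiff_const.mul ((hFs.norm ℝ hF0).inv fun x => norm_ne_zero_iff.2 (hF0 x))).smul hFs
  · intro x
    have := norm_ne_zero_iff.2 (hF0 x)
    rw [norm_smul, norm_mul, norm_inv, norm_norm, Real.norm_of_nonneg hR.le]
    field_simp
  · intro x hx
    have : F x = x := by
      simp only [F]
      rw [χ.zero_of_le_dist (by simp [hx, χ]), zero_smul, sub_zero]
    simp only [this, hx]
    rw [mul_inv_cancel₀ hR.ne', one_smul]

/-- **Quantitative surjectivity (degree-theoretic consequence of Brouwer).**
Let `B̄` be the closed ball of center `c` and radius `r > 0` in `ℝ^m`, and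
`Φ : B̄ → ℝ^m` continuous. If `‖x₀ − c‖ < r` and `‖Φ(x) − x‖ < r − ‖x₀ − c‖`
for every `x ∈ B̄`, then `x₀ ∈ Φ(B̄)`. -/
theorem quantitative_surjectivity (m : ℕ) (hm : 1 ≤ m)
    (c : EuclideanSpace ℝ (Fin m)) (r : ℝ) (hr : 0 < r)
    (Φ : EuclideanSpace ℝ (Fin m) → EuclideanSpace ℝ (Fin m))
    (hcont : ContinuousOn Φ (Metric.closedBall c r))
    (x₀ : EuclideanSpace ℝ (Fin m)) (hx₀ : ‖x₀ - c‖ < r)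
    (hΦ : ∀ x ∈ Metric.closedBall c r, ‖Φ x - x‖ < r - ‖x₀ - c‖) :
    x₀ ∈ Φ '' Metric.closedBall c r := by
  let P : EuclideanSpace ℝ (Fin m) → EuclideanSpace ℝ (Fin m) :=
    fun x => c + (r * (max r ‖x‖)⁻¹) • x
  have hmax : ∀ x : EuclideanSpace ℝ (Fin m), 0 < max r ‖x‖ := fun x => lt_max_of_lt_left hr
  have hPc : Continuous P := by
    have : Continuous fun x : EuclideanSpace ℝ (Fin m) => (max r ‖x‖)⁻¹ :=
      (continuous_const.max continuous_norm).inv₀ fun x => (hmax x).ne'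
    fun_prop
  have hPm : ∀ x, P x ∈ closedBall c r := by
    intro x
    simp only [P, mem_closedBall, dist_eq_norm, add_sub_cancel_left]
    rw [norm_smul, norm_mul, norm_inv, Real.norm_of_nonneg hr.le, Real.norm_of_nonneg (hmax x).le,
      mul_assoc, inv_mul_eq_div]
    exact mul_le_of_le_one_right hr.le ((div_le_one (hmax x)).2 (le_max_right _ _))
  have hΦc : Continuous fun x => Φ (P x) := hcont.comp_continuous hPc hPm
  have hbd : ∀ x, ‖(x₀ - c) - (Φ (P x) - P x)‖ ≤ r := by
    intro x
    have := norm_sub_le (x₀ - c) (Φ (P x) - P x)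
    linarith [hΦ _ (hPm x)]
  obtain ⟨x, hx⟩ := qs_brouwer (fun x => (x₀ - c) - (Φ (P x) - P x))
    (continuous_const.sub (hΦc.sub hPc)) hbd
  have hxr : ‖x‖ ≤ r := by rw [← hx]; exact hbd x
  have hPx : P x = c + x := by
    simp only [P]
    rw [max_eq_left hxr, mul_inv_cancel₀ hr.ne', one_smul]
  refine ⟨P x, hPm x, ?_⟩
  have : x₀ - c - (Φ (P x) - (c + x)) = x := by rw [← hPx]; exact hx
  have h2 : x₀ - Φ (P x) = 0 := by
    have e : x₀ - Φ (P x) = (x₀ - c - (Φ (P x) - (c + x))) - x := by abel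
    rw [e, this, sub_self]
  exact (sub_eq_zero.1 h2).symm
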